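/- arXiv:1109.2944 — 6 statements merged into one kernel-verified Lean document; each statement's English description precedes it below -/
import Mathlib

section
/- Let J, K be positive integers, let c : Fin J → ℝ be nonnegative with (K−1)·(max_{1≤j≤J} c_j) + ∑_{j=1}^J c_j = 1. Suppose d' : Fin J → Fin K → ℝ satisfies the outer-bound inequality ∑_{k=1}^K d'_{j,k} + max_{1≤k≤K} ∑_{j'≠j} d'_{j',k} ≤ 1 at every receiver j, and that d'_{j,k} ≥ c_j for all j, k. Then d'_{j,k} = c_j for all j, k. (Hence the row-constant point d_{j,k} = c_j lies on the boundary of the region defined by the outer bound.) -/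
open Finset MeasureTheory

/-- Maximum of a real-valued function over the (nonempty) index type `Fin K`. -/
noncomputable def finMax {K : ℕ} [NeZero K] (f : Fin K → ℝ) : ℝ :=
  Finset.univ.sup' Finset.univ_nonempty f

/-- `permMax d σ jhat jtilde` is the maximum (0 if the set is empty) of the set
`{ d j k : k ∈ Fin K, j ∈ Fin J, j ≠ jhat, σ_k(j) = jtilde }` appearing in the
permuted-alignment inequality (eq. perm). -/
noncomputable def permMax {J K : ℕ} (d : Fin J → Fin K → ℝ) (σ : Fin K → Equiv.Perm (Fin J))
    (jhat jtilde : Fin J) : ℝ :=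
  ((Finset.univ : Finset (Fin J × Fin K)).filter
    (fun p => p.1 ≠ jhat ∧ σ p.2 p.1 = jtilde)).fold max 0 (fun p => d p.1 p.2)

/-- the row-constant point `d_{j,k} = c_j` with
`(K-1)*(max c) + ∑ c = 1` lies on the boundary of the outer-bound region: any
point satisfying the outer bound that dominates it componentwise equals it. -/
theorem row_constant_point_on_outer_boundary (J K : ℕ) [NeZero J] [NeZero K]
    (c : Fin J → ℝ) (hc : ∀ j, 0 ≤ c j)
    (hsum : ((K : ℝ) - 1) * finMax c + (∑ j : Fin J, c j) = 1)
    (d' : Fin J → Fin K → ℝ)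
    (houter : ∀ j : Fin J,
      (∑ k : Fin K, d' j k) +
        finMax (fun k : Fin K => ∑ j' ∈ Finset.univ.erase j, d' j' k) ≤ 1)
    (hdom : ∀ j k, c j ≤ d' j k) :
    ∀ j k, d' j k = c j := by
  obtain ⟨m, -, hm⟩ := Finset.exists_mem_eq_sup' (Finset.univ_nonempty) c
  have hm' : finMax c = c m := hm
  rw [hm'] at hsum
  have hsplit := Finset.add_sum_erase Finset.univ c (Finset.mem_univ m)
  have hA : ∑ _k : Fin K, c m ≤ ∑ k : Fin K, d' m k :=
    Finset.sum_le_sum fun k _ => hdom m k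
  have hconst : ∑ _k : Fin K, c m = (K : ℝ) * c m := by simp
  intro j k
  have hB : ∑ j' ∈ Finset.univ.erase m, c j' ≤ ∑ j' ∈ Finset.univ.erase m, d' j' k :=
    Finset.sum_le_sum fun j' _ => hdom j' k
  have hle : ∑ j' ∈ Finset.univ.erase m, d' j' k ≤
      finMax (fun k : Fin K => ∑ j' ∈ Finset.univ.erase m, d' j' k) :=
    Finset.le_sup' (fun k : Fin K => ∑ j' ∈ Finset.univ.erase m, d' j' k) (Finset.mem_univ k)
  have ho := houter m
  by_cases hj : j = m
  · subst hj
    have h : ∑ _k : Fin K, c j = ∑ k : Fin K, d' j k := by linarith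
    exact ((Finset.sum_eq_sum_iff_of_le fun k _ => hdom j k).1 h k (Finset.mem_univ k)).symm
  · have h : ∑ j' ∈ Finset.univ.erase m, c j' = ∑ j' ∈ Finset.univ.erase m, d' j' k := by
      linarith
    exact ((Finset.sum_eq_sum_iff_of_le fun j' _ => hdom j' k).1 h j
      (Finset.mem_erase.2 ⟨hj, Finset.mem_univ j⟩)).symm
end

section
/- Let J, K be positive integers and let d : Fin J → Fin K → ℝ be a matrix with all entries nonnegative that satisfies the outer-bound inequality ∑_{k=1}^K d_{j,k} + max_{1≤k≤K} ∑_{j'≠j} d_{j',k} ≤ 1 at every receiver j. Then the total degrees of freedom satisfies ∑_{j=1}^J ∑_{k=1}^K d_{j,k} ≤ JK/(J+K−1). -/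
open Finset MeasureTheory

/-- the outer-bound inequalities imply the total DoF bound
`∑ d ≤ JK/(J+K-1)`. -/
theorem total_dof_bound_of_outer_bound (J K : ℕ) [NeZero J] [NeZero K]
    (d : Fin J → Fin K → ℝ) (hd : ∀ j k, 0 ≤ d j k)
    (houter : ∀ j : Fin J,
      (∑ k : Fin K, d j k) +
        finMax (fun k : Fin K => ∑ j' ∈ Finset.univ.erase j, d j' k) ≤ 1) :
    ∑ j : Fin J, ∑ k : Fin K, d j k ≤ (J : ℝ) * K / ((J : ℝ) + K - 1) := by
  have h1 : ∀ j k, (∑ k' : Fin K, d j k') + ((∑ j' : Fin J, d j' k) - d j k) ≤ 1 := by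
    intro j k
    have h2 : (∑ j' ∈ Finset.univ.erase j, d j' k) ≤
        finMax (fun k : Fin K => ∑ j' ∈ Finset.univ.erase j, d j' k) :=
      Finset.le_sup' (fun k : Fin K => ∑ j' ∈ Finset.univ.erase j, d j' k) (Finset.mem_univ k)
    have h3 := Finset.add_sum_erase Finset.univ (fun j' => d j' k) (Finset.mem_univ j)
    have h4 := houter j
    linarith
  have hS : ∑ j : Fin J, ∑ k : Fin K,
      ((∑ k' : Fin K, d j k') + ((∑ j' : Fin J, d j' k) - d j k)) ≤
      ∑ j : Fin J, ∑ k : Fin K, (1 : ℝ) :=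
    Finset.sum_le_sum fun j _ => Finset.sum_le_sum fun k _ => h1 j k
  simp only [Finset.sum_add_distrib, Finset.sum_sub_distrib, Finset.sum_const, Finset.card_univ,
    Fintype.card_fin, nsmul_eq_mul, ← Finset.mul_sum, mul_one] at hS
  rw [Finset.sum_comm (f := fun k j => d j k)] at hS
  have hJ : (1 : ℝ) ≤ J := by exact_mod_cast Nat.one_le_iff_ne_zero.mpr (NeZero.ne J)
  have hK : (1 : ℝ) ≤ K := by exact_mod_cast Nat.one_le_iff_ne_zero.mpr (NeZero.ne K)
  rw [le_div_iff₀ (by linarith)]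
  linarith
end

section
/- Let J, K be positive integers, let d : Fin J → Fin K → ℝ be a matrix with all entries nonnegative, and let σ_1,…,σ_K be permutations of {1,…,J} such that the permuted-alignment inequality ∑_{k=1}^K d_{ĵ,k} + ∑_{j̃=1}^J max{ d_{j,k} : 1≤k≤K, j≠ĵ, σ_k(j)=j̃ } ≤ 1 holds at every receiver ĵ. Then d satisfies the outer-bound inequality ∑_{k=1}^K d_{ĵ,k} + max_{1≤k≤K} ∑_{j≠ĵ} d_{j,k} ≤ 1 at every receiver ĵ. In particular the permuted-alignment region D^(in)_0 is contained in the outer-bound region. -/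
open Finset MeasureTheory

/-- the permuted-alignment inequalities (eq. perm, for any choice
of permutations) imply the outer-bound inequalities (eq. alter); in particular
the permuted-alignment region D^(in)_0 is contained in the outer-bound region. -/
theorem permuted_alignment_implies_outer_bound (J K : ℕ) [NeZero J] [NeZero K]
    (d : Fin J → Fin K → ℝ) (hd : ∀ j k, 0 ≤ d j k)
    (σ : Fin K → Equiv.Perm (Fin J))
    (hperm : ∀ jhat : Fin J,
      (∑ k : Fin K, d jhat k) + (∑ jtilde : Fin J, permMax d σ jhat jtilde) ≤ 1) :
    ∀ jhat : Fin J,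
      (∑ k : Fin K, d jhat k) +
        finMax (fun k : Fin K => ∑ j ∈ Finset.univ.erase jhat, d j k) ≤ 1 := by
  intro jhat
  refine le_trans (add_le_add le_rfl ?_) (hperm jhat)
  unfold finMax
  refine Finset.sup'_le _ _ fun k _ => ?_
  have h0 : ∀ jt, 0 ≤ permMax d σ jhat jt := fun jt =>
    (Finset.le_fold_max (0 : ℝ)).2 (Or.inl le_rfl)
  have h1 : ∀ j ∈ Finset.univ.erase jhat, d j k ≤ permMax d σ jhat (σ k j) := by
    intro j hj
    refine (Finset.le_fold_max (d j k)).2 (Or.inr ⟨(j, k), ?_, le_rfl⟩)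
    simpa using hj
  calc ∑ j ∈ Finset.univ.erase jhat, d j k
      ≤ ∑ j ∈ Finset.univ.erase jhat, permMax d σ jhat (σ k j) := Finset.sum_le_sum h1
    _ ≤ ∑ j, permMax d σ jhat (σ k j) :=
        Finset.sum_le_sum_of_subset_of_nonneg (Finset.subset_univ _) fun j _ _ => h0 _
    _ = ∑ j, permMax d σ jhat j := Equiv.sum_comp (σ k) (permMax d σ jhat)
end

section
/- Let J = 4 receivers and K = 3 transmitters, let M : Fin 4 → Fin 3 → ℝ be the matrix with rows (indexed by receivers) M_1 = (4,2,1), M_2 = (0,2,1), M_3 = (0,0,1), M_4 = (0,0,1), and let c ≥ 0. If there exist permutations σ_1, σ_2, σ_3 of {1,2,3,4} such that the matrix c·M satisfies the permuted-alignment inequality at every receiver ĵ, then c ≤ 1/11. (Thus permuted alignment without staggering can achieve a DoF point proportional to M only with coefficient at most 1/11, not 1/10.) -/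
open Finset MeasureTheory

lemma le_permMax_aux {J K : ℕ} (d : Fin J → Fin K → ℝ) (σ : Fin K → Equiv.Perm (Fin J))
    (jhat jtilde j : Fin J) (k : Fin K) (h1 : j ≠ jhat) (h2 : σ k j = jtilde) :
    d j k ≤ permMax d σ jhat jtilde := by
  unfold permMax
  rw [Finset.le_fold_max]
  right
  exact ⟨(j, k), by simp [h1, h2], le_rfl⟩

lemma permMax_nonneg_aux {J K : ℕ} (d : Fin J → Fin K → ℝ) (σ : Fin K → Equiv.Perm (Fin J))
    (jhat jtilde : Fin J) : 0 ≤ permMax d σ jhat jtilde := by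
  unfold permMax
  rw [Finset.le_fold_max]
  left
  exact le_rfl

lemma count_aux : ∀ a b : Fin 4,
    4 ≤ ∑ t : Fin 4, (if t = a then 2 else if t = b then 0 else 1 : ℕ) := by decide

/-- if some choice of permutations makes `c·M` (M the
staggered-alignment example matrix) satisfy the permuted-alignment inequality
at every receiver, then c ≤ 1/11. -/
theorem permuted_alignment_coefficient_at_most_one_eleventh
    (M : Fin 4 → Fin 3 → ℝ)
    (hM : M = ![![4, 2, 1], ![0, 2, 1], ![0, 0, 1], ![0, 0, 1]])
    (c : ℝ) (hc : 0 ≤ c)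
    (d : Fin 4 → Fin 3 → ℝ) (hd : d = fun j k => c * M j k)
    (σ : Fin 3 → Equiv.Perm (Fin 4))
    (hperm : ∀ jhat : Fin 4,
      (∑ k : Fin 3, d jhat k) + (∑ jtilde : Fin 4, permMax d σ jhat jtilde) ≤ 1) :
    c ≤ 1 / 11 := by
  have hlow : ∀ t : Fin 4,
      c * ((if t = σ 1 1 then 2 else if t = σ 2 0 then 0 else 1 : ℕ) : ℝ) ≤ permMax d σ 0 t := by
    intro t
    split_ifs with h1 h2
    · have := le_permMax_aux d σ 0 t 1 1 (by decide) h1.symm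
      simpa [hd, hM] using this
    · simpa using permMax_nonneg_aux d σ 0 t
    · have hne : (σ 2).symm t ≠ 0 := by
        intro h
        apply h2
        rw [← h]; simp
      have := le_permMax_aux d σ 0 t ((σ 2).symm t) 2 hne (by simp)
      have hv : ∀ j : Fin 4, d j 2 = c := by
        intro j
        fin_cases j <;> simp [hd, hM]
      rw [hv] at this
      simpa using this
  have hs := Finset.sum_le_sum (fun t (_ : t ∈ (Finset.univ : Finset (Fin 4))) => hlow t)
  rw [← Finset.mul_sum, ← Nat.cast_sum] at hs
  have hcnt : (4 : ℝ) ≤ _ := Nat.cast_le (α := ℝ).mpr (count_aux (σ 1 1) (σ 2 0))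
  have h4 := mul_le_mul_of_nonneg_left hcnt hc
  have h0 := hperm 0
  have h7 : ∑ k : Fin 3, d 0 k = 7 * c := by
    simp [Fin.sum_univ_three, hd, hM]; ring
  rw [h7] at h0
  linarith
end

section
/- Let n be a positive integer and let S be a finite set of exponent vectors p : Fin n → ℕ (all distinct as elements of the set). Then for Lebesgue-almost every x ∈ ℝ^n, the family of real numbers ( ∏_{i=1}^n x_i^{p(i)} )_{p ∈ S} is linearly independent over ℚ. In particular, for almost every choice of channel coefficients and design parameters, the finitely many transmit/receive directions used in the real interference alignment scheme, which are monomials with distinct exponent vectors in these variables, are rationally independent. -/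
open Finset MeasureTheory

theorem mvPoly_ae_ne_zero : ∀ (n : ℕ) (p : MvPolynomial (Fin n) ℝ), p ≠ 0 →
    ∀ᵐ x ∂(volume : Measure (Fin n → ℝ)), MvPolynomial.eval x p ≠ 0 := by
  intro n
  induction n with
  | zero =>
    intro p hp
    refine Filter.Eventually.of_forall fun x hx => hp ?_
    rw [MvPolynomial.eq_C_of_isEmpty p] at hx ⊢
    rw [MvPolynomial.eval_C] at hx
    rw [hx, map_zero]
  | succ n ih =>
    intro p hp
    have hq : MvPolynomial.finSuccEquiv ℝ n p ≠ 0 := by simpa using hp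
    have hc := ih _ (Polynomial.leadingCoeff_ne_zero.mpr hq)
    have hmp := volume_preserving_piFinSuccAbove (fun _ : Fin (n + 1) => ℝ) 0
    have hcont : Continuous fun z : ℝ × (Fin n → ℝ) =>
        MvPolynomial.eval (Fin.cons z.1 z.2 : Fin (n + 1) → ℝ) p :=
      (MvPolynomial.continuous_eval p).comp (Continuous.finCons continuous_fst continuous_snd)
    have hmeas : MeasurableSet {z : ℝ × (Fin n → ℝ) |
        MvPolynomial.eval (Fin.cons z.1 z.2 : Fin (n + 1) → ℝ) p ≠ 0} :=
      (isOpen_ne_fun hcont continuous_const).measurableSet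
    have key : ∀ᵐ z ∂((volume : Measure ℝ).prod (volume : Measure (Fin n → ℝ))),
        MvPolynomial.eval (Fin.cons z.1 z.2 : Fin (n + 1) → ℝ) p ≠ 0 := by
      rw [Measure.ae_prod_iff_ae_ae hmeas, Measure.ae_ae_comm hmeas]
      filter_upwards [hc] with s hs
      have hne : Polynomial.map (MvPolynomial.eval s) (MvPolynomial.finSuccEquiv ℝ n p) ≠ 0 := by
        intro h
        apply hs
        have := congrArg (fun r => Polynomial.coeff r
          (MvPolynomial.finSuccEquiv ℝ n p).natDegree) h
        simpa [Polynomial.coeff_map] using this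
      have hfin := (Polynomial.finite_setOf_isRoot hne).measure_zero (volume : Measure ℝ)
      filter_upwards [measure_eq_zero_iff_ae_notMem.mp hfin] with y hy h
      apply hy
      rw [MvPolynomial.eval_eq_eval_mv_eval'] at h
      exact h
    have := hmp.quasiMeasurePreserving.ae key
    filter_upwards [this] with x hx
    have e : (Fin.cons (x 0) (fun i => x (Fin.succ i)) : Fin (n + 1) → ℝ) = x :=
      Fin.cons_self_tail x
    rw [← e]
    exact hx

/-- for Lebesgue-almost every `x ∈ ℝ^n`, any finite family of
monomials `∏ i, x i ^ p i` indexed by distinct exponent vectors `p ∈ S` is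
linearly independent over ℚ (rationally independent). -/
theorem monomials_rationally_independent_ae (n : ℕ) (hn : 0 < n)
    (S : Finset (Fin n → ℕ)) :
    ∀ᵐ x ∂(volume : Measure (Fin n → ℝ)),
      LinearIndependent ℚ (fun p : S => ∏ i : Fin n, x i ^ (p : Fin n → ℕ) i) := by
  have h : ∀ᵐ x ∂(volume : Measure (Fin n → ℝ)), ∀ c : S → ℚ, c ≠ 0 →
      ∑ p : S, c p • ∏ i : Fin n, x i ^ (p : Fin n → ℕ) i ≠ 0 := by
    rw [ae_all_iff]
    intro c
    by_cases hc : c = 0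
    · simp [hc]
    let P : MvPolynomial (Fin n) ℝ :=
      ∑ p : S, MvPolynomial.monomial (Finsupp.equivFunOnFinite.symm (p : Fin n → ℕ)) (c p : ℝ)
    have hP : P ≠ 0 := by
      intro h0
      apply hc
      funext q
      have := congrArg
        (MvPolynomial.coeff (Finsupp.equivFunOnFinite.symm (q : Fin n → ℕ))) h0
      simpa [P, MvPolynomial.coeff_sum, MvPolynomial.coeff_monomial, Subtype.coe_inj] using this
    filter_upwards [mvPoly_ae_ne_zero n P hP] with x hx _ h0
    apply hx
    rw [← h0]
    simp only [P, map_sum, MvPolynomial.eval_monomial, Rat.smul_def]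
    refine Finset.sum_congr rfl fun p _ => ?_
    rw [Finsupp.prod_fintype _ _ (by simp)]
    rfl
  filter_upwards [h] with x hx
  rw [Fintype.linearIndependent_iff]
  intro c h0 i
  by_contra hi
  exact hx c (fun hc => hi (by simp [hc])) h0
end

section
/- Let m be a positive integer. For Lebesgue-almost every v ∈ ℝ^m, for every ε > 0 there exists a constant c > 0 such that for all q ∈ ℤ^m with q ≠ 0 and all p ∈ ℤ, |p + ∑_{i=1}^m q_i v_i| ≥ c / (max_{1≤i≤m} |q_i|)^{m+ε}. -/
open Finset MeasureTheory

lemma kg_sup_pos {m : ℕ} (q : Fin m → ℤ) (hq : q ≠ 0) :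
    1 ≤ (Finset.univ.sup fun i : Fin m => (q i).natAbs) := by
  obtain ⟨i, hi⟩ := Function.ne_iff.1 hq
  have h := Finset.le_sup (f := fun i : Fin m => (q i).natAbs) (Finset.mem_univ i)
  have : (q i).natAbs ≠ 0 := by simpa using hi
  omega

lemma kg_norm {m : ℕ} (q : Fin m → ℤ) :
    ‖(fun i => (q i : ℝ))‖ = ((Finset.univ.sup fun i : Fin m => (q i).natAbs : ℕ) : ℝ) := by
  apply le_antisymm
  · rw [pi_norm_le_iff_of_nonneg (by positivity)]
    intro i
    have h := Finset.le_sup (f := fun i : Fin m => (q i).natAbs) (Finset.mem_univ i)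
    have h2 : ‖(q i : ℝ)‖ = ((q i).natAbs : ℝ) := by
      rw [Real.norm_eq_abs, Nat.cast_natAbs, Int.cast_abs]
    rw [h2]
    exact_mod_cast h
  · have : (Finset.univ.sup fun i : Fin m => (q i).natAbs) ≤ ⌊‖(fun i => (q i : ℝ))‖⌋₊ := by
      apply Finset.sup_le
      intro i _
      apply Nat.le_floor
      have h2 : ‖(q i : ℝ)‖ = ((q i).natAbs : ℝ) := by
        rw [Real.norm_eq_abs, Nat.cast_natAbs, Int.cast_abs]
      rw [← h2]
      exact norm_le_pi_norm (fun i => (q i : ℝ)) i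
    exact (Nat.cast_le.2 this).trans (Nat.floor_le (norm_nonneg _))

lemma kg_summable (m : ℕ) (ε : ℝ) (hε : 0 < ε) :
    Summable fun q : Fin m → ℤ =>
      (((Finset.univ.sup fun i : Fin m => (q i).natAbs : ℕ) : ℝ) ^ (-((m : ℝ) + ε))) := by
  let L := Submodule.span ℤ (Set.range (Pi.basisFun ℝ (Fin m)))
  have hL : Module.finrank ℤ L = m := by
    rw [ZLattice.rank ℝ L]; simp
  have hs := ZLattice.summable_norm_rpow L (-((m : ℝ) + ε)) (by rw [hL]; linarith)
  have hmem : ∀ q : Fin m → ℤ, (fun i => (q i : ℝ)) ∈ L := by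
    intro q
    have : (fun i => (q i : ℝ)) = ∑ i, q i • (Pi.basisFun ℝ (Fin m) i) := by
      ext j
      simp [Finset.sum_apply, Pi.single_apply]
    rw [this]
    exact Submodule.sum_mem _ fun i _ => Submodule.smul_mem _ _ (Submodule.subset_span ⟨i, rfl⟩)
  let f : (Fin m → ℤ) → L := fun q => ⟨_, hmem q⟩
  have hf : Function.Injective f := by
    intro a b h
    have h := congrArg Subtype.val h
    ext i
    have h3 : (a i : ℝ) = (b i : ℝ) := congrFun h i
    exact_mod_cast h3
  refine (hs.comp_injective hf).congr fun q => ?_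
  simp only [Function.comp, f, Submodule.coe_norm]
  rw [kg_norm]

lemma kg_det {m : ℕ} (i : Fin m) (w : Fin m → ℝ) :
    (Matrix.updateRow (1 : Matrix (Fin m) (Fin m) ℝ) i w).det = w i := by
  rw [← Matrix.cramer_transpose_apply]
  simp

lemma kg_slab {m : ℕ} (R : ℕ) (hR : 0 < R) (q : Fin m → ℤ) (hq : q ≠ 0) (δ : ℝ) (hδ : 0 < δ)
    (hδ1 : δ ≤ 1) :
    volume ({v : Fin m → ℝ | ∀ i, |v i| < R} ∩
      {v | ∃ p : ℤ, |(p : ℝ) + ∑ i : Fin m, (q i : ℝ) * v i| < δ}) ≤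
      ENNReal.ofReal (((2 * m * R + 3) * 2 * (2 * R) ^ (m - 1)) * δ) := by
  set N := (Finset.univ.sup fun i : Fin m => (q i).natAbs) with hN
  have hN1 : 1 ≤ N := kg_sup_pos q hq
  have hle : ∀ i, |(q i : ℝ)| ≤ N := by
    intro i
    have h := Finset.le_sup (f := fun i : Fin m => (q i).natAbs) (Finset.mem_univ i)
    rw [← hN] at h
    rw [← Int.cast_abs, ← Nat.cast_natAbs]
    exact_mod_cast h
  obtain ⟨i, hi⟩ : ∃ i, |(q i : ℝ)| = N := by
    obtain ⟨j, _⟩ := Function.ne_iff.1 hq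
    obtain ⟨i, _, hi⟩ := Finset.exists_mem_eq_sup (Finset.univ : Finset (Fin m)) ⟨j, mem_univ j⟩
      (fun i : Fin m => (q i).natAbs)
    refine ⟨i, ?_⟩
    rw [hN, hi, ← Int.cast_abs, ← Nat.cast_natAbs]
  have hm : 0 < m := i.pos
  set A := Matrix.updateRow (1 : Matrix (Fin m) (Fin m) ℝ) i (fun j => (q j : ℝ)) with hA
  have hdet : LinearMap.det (Matrix.toLin' A) = (q i : ℝ) := by
    rw [LinearMap.det_toLin', hA, kg_det]
  have hNpos : (0:ℝ) < N := by exact_mod_cast hN1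
  have hqi : (q i : ℝ) ≠ 0 := by
    intro h; rw [h] at hi; simp at hi; linarith
  set M : ℕ := m * N * R + 1 with hM
  let S : Set ℝ := ⋃ p ∈ Finset.Icc (-(M:ℤ)) M, Set.Ioo (-(p:ℝ) - δ) (-p + δ)
  let T : Set (Fin m → ℝ) := Set.pi Set.univ
    (Function.update (fun _ : Fin m => Set.Ioo (-(R:ℝ)) R) i S)
  have hsub : ({v : Fin m → ℝ | ∀ i, |v i| < R} ∩
      {v | ∃ p : ℤ, |(p : ℝ) + ∑ i : Fin m, (q i : ℝ) * v i| < δ}) ⊆ (Matrix.toLin' A) ⁻¹' T := by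
    rintro v ⟨hv, p, hp⟩
    simp only [Set.mem_ofPred_eq] at hv
    simp only [Set.mem_preimage, T, Set.mem_pi, Set.mem_univ, true_implies]
    intro j
    rw [Matrix.toLin'_apply]
    by_cases hj : j = i
    · subst hj
      have e : (A.mulVec v) j = ∑ k, (q k : ℝ) * v k := by
        simp [hA, Matrix.mulVec, dotProduct]
      rw [e, Function.update_self]
      have hb : |∑ k, (q k : ℝ) * v k| ≤ m * N * R := by
        calc _ ≤ ∑ k, |(q k : ℝ) * v k| := Finset.abs_sum_le_sum_abs _ _
          _ ≤ ∑ k : Fin m, (N * R : ℝ) := by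
            refine Finset.sum_le_sum fun k _ => ?_
            rw [abs_mul]
            exact mul_le_mul (hle k) (hv k).le (abs_nonneg _) hNpos.le
          _ = _ := by simp; ring
      have hp' := abs_lt.1 hp
      have hb' := abs_le.1 hb
      simp only [S, Set.mem_iUnion]
      refine ⟨p, ?_, ?_⟩
      · rw [Finset.mem_Icc]
        constructor
        · have : (-(M:ℝ)) ≤ p := by rw [hM]; push_cast; linarith
          exact_mod_cast this
        · have : (p:ℝ) ≤ M := by rw [hM]; push_cast; linarith
          exact_mod_cast this
      · constructor <;> linarith
    · have e : (A.mulVec v) j = v j := by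
        simp [hA, Matrix.mulVec, Matrix.updateRow_ne hj]
        simp [dotProduct, Matrix.one_apply]
      rw [e, Function.update_of_ne hj]
      exact abs_lt.1 (hv j)
  have hS : volume S ≤ ENNReal.ofReal ((2 * M + 1) * (2 * δ)) := by
    calc volume S ≤ ∑ p ∈ Finset.Icc (-(M:ℤ)) M, volume (Set.Ioo (-(p:ℝ) - δ) (-p + δ)) :=
          measure_biUnion_finset_le _ _
      _ = ∑ p ∈ Finset.Icc (-(M:ℤ)) M, ENNReal.ofReal (2 * δ) := by
          refine Finset.sum_congr rfl fun p _ => ?_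
          rw [Real.volume_Ioo]; congr 1; ring
      _ = _ := by
          have : (2 * (M:ℝ) + 1) = ((2 * M + 1 : ℕ) : ℝ) := by push_cast; ring
          rw [Finset.sum_const, Int.card_Icc, nsmul_eq_mul, this,
            ENNReal.ofReal_mul (p := ((2 * M + 1 : ℕ) : ℝ)) (by positivity), ENNReal.ofReal_natCast]
          congr 2
          omega
  have hT : volume T ≤ ENNReal.ofReal ((2 * M + 1) * (2 * δ) * (2 * R) ^ (m - 1)) := by
    rw [volume_pi_pi, ← Finset.mul_prod_erase _ _ (Finset.mem_univ i), Function.update_self,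
      ENNReal.ofReal_mul (by positivity)]
    refine mul_le_mul' hS (le_of_eq ?_)
    rw [Finset.prod_congr rfl (g := fun _ => ENNReal.ofReal (2 * R))]
    · rw [Finset.prod_const, Finset.card_erase_of_mem (Finset.mem_univ i),
        ENNReal.ofReal_pow (by positivity)]
      simp
    · intro j hj
      rw [Function.update_of_ne (Finset.ne_of_mem_erase hj), Real.volume_Ioo]
      congr 1; ring
  calc _ ≤ volume ((Matrix.toLin' A) ⁻¹' T) := measure_mono hsub
    _ = ENNReal.ofReal |(q i : ℝ)⁻¹| * volume T := by
      rw [Measure.addHaar_preimage_linearMap _ (by rw [hdet]; exact hqi), hdet]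
    _ ≤ ENNReal.ofReal |(q i : ℝ)⁻¹| *
        ENNReal.ofReal ((2 * M + 1) * (2 * δ) * (2 * R) ^ (m - 1)) := by gcongr
    _ ≤ _ := by
      rw [← ENNReal.ofReal_mul (by positivity), abs_inv, hi]
      apply ENNReal.ofReal_le_ofReal
      have h3 : (N:ℝ)⁻¹ * (2 * M + 1) ≤ 2 * m * R + 3 := by
        rw [inv_mul_le_iff₀ hNpos, hM]
        push_cast
        have : (1:ℝ) ≤ N := by exact_mod_cast hN1
        nlinarith
      calc _ = ((N:ℝ)⁻¹ * (2 * M + 1)) * (2 * δ * (2 * R) ^ (m - 1)) := by ring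
        _ ≤ (2 * m * R + 3) * (2 * δ * (2 * R) ^ (m - 1)) := by gcongr
        _ = _ := by ring

lemma kg_box (m R : ℕ) (hR : 0 < R) (ε : ℝ) (hε : 0 < ε) :
    ∀ᵐ v ∂(volume : Measure (Fin m → ℝ)).restrict {v | ∀ i, |v i| < R},
      ∃ c : ℝ, 0 < c ∧ ∀ q : Fin m → ℤ, q ≠ 0 → ∀ p : ℤ,
          c / (((Finset.univ.sup fun i : Fin m => (q i).natAbs : ℕ) : ℝ) ^ ((m : ℝ) + ε))
            ≤ |(p : ℝ) + ∑ i : Fin m, (q i : ℝ) * v i| := by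
  set N : (Fin m → ℤ) → ℕ := fun q => Finset.univ.sup fun i : Fin m => (q i).natAbs with hN
  set B : Set (Fin m → ℝ) := {v | ∀ i, |v i| < R} with hB
  set C : ℝ := ((2 * m * R + 3) * 2 * (2 * R) ^ (m - 1)) with hC
  have hC0 : 0 ≤ C := by positivity
  have hBm : MeasurableSet B := by
    rw [hB]
    simp only [Set.ofPred_forall]
    exact MeasurableSet.iInter fun i => measurableSet_lt (by fun_prop) (by fun_prop)
  have hslab : ∀ q : Fin m → ℤ, q ≠ 0 → ∀ δ : ℝ, 0 < δ → δ ≤ 1 → (volume.restrict B)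
      {v | ∃ p : ℤ, |(p : ℝ) + ∑ i : Fin m, (q i : ℝ) * v i| < δ} ≤ ENNReal.ofReal (C * δ) := by
    intro q hq δ h1 h2
    rw [Measure.restrict_apply' hBm, Set.inter_comm]
    exact kg_slab R hR q hq δ h1 h2
  let s : (Fin m → ℤ) → Set (Fin m → ℝ) := fun q =>
    {v | q ≠ 0 ∧ ∃ p : ℤ, |(p : ℝ) + ∑ i : Fin m, (q i : ℝ) * v i| < (N q : ℝ) ^ (-((m:ℝ) + ε))}
  have hsum : ∑' q, (volume.restrict B) (s q) ≠ ⊤ := by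
    have hs := (kg_summable m ε hε).mul_left C
    refine ne_top_of_le_ne_top hs.tsum_ofReal_ne_top (ENNReal.tsum_le_tsum fun q => ?_)
    by_cases hq : q = 0
    · simp [s, hq]
    · have h1 : (1:ℝ) ≤ N q := by exact_mod_cast kg_sup_pos q hq
      refine (measure_mono ?_).trans (hslab q hq _ (Real.rpow_pos_of_pos (by linarith) _)
        (Real.rpow_le_one_of_one_le_of_nonpos h1 (by linarith [(Nat.cast_nonneg m : (0:ℝ) ≤ m)])))
      intro v hv
      exact hv.2
  have hBC := measure_limsup_cofinite_eq_zero hsum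
  have hBC' : ∀ᵐ v ∂(volume.restrict B), ∀ᶠ q in Filter.cofinite, v ∉ s q := by
    rw [ae_iff]
    convert hBC using 2
    ext v
    simp [Filter.mem_limsup_iff_frequently_mem, Filter.Frequently]
  have hz : ∀ᵐ v ∂(volume.restrict B), ∀ q : Fin m → ℤ, q ≠ 0 → ∀ p : ℤ,
      (p : ℝ) + ∑ i : Fin m, (q i : ℝ) * v i ≠ 0 := by
    rw [ae_all_iff]
    intro q
    by_cases hq : q = 0
    · simp [hq]
    have h0 : (volume.restrict B) {v | ∃ p : ℤ, (p : ℝ) + ∑ i : Fin m, (q i : ℝ) * v i = 0} = 0 := by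
      have ht : Filter.Tendsto (fun δ : ℝ => ENNReal.ofReal (C * δ)) (nhdsWithin 0 (Set.Ioi 0))
          (nhds 0) := by
        have : Filter.Tendsto (fun δ : ℝ => ENNReal.ofReal (C * δ)) (nhds 0)
          (nhds (ENNReal.ofReal (C * 0))) :=
          (ENNReal.continuous_ofReal.comp (continuous_const.mul continuous_id)).tendsto 0
        simp only [mul_zero, ENNReal.ofReal_zero] at this
        exact this.mono_left nhdsWithin_le_nhds
      refine le_antisymm (ge_of_tendsto ht ?_) (zero_le)
      filter_upwards [Ioc_mem_nhdsGT (zero_lt_one' ℝ)] with δ hδ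
      refine (measure_mono ?_).trans (hslab q hq δ hδ.1 hδ.2)
      rintro v ⟨p, hp⟩
      exact ⟨p, by rw [hp, abs_zero]; exact hδ.1⟩
    rw [ae_iff]
    convert h0 using 2
    ext v
    simp [hq]
  filter_upwards [hBC', hz] with v h1 h2
  have hfin : {q | ¬ v ∉ s q}.Finite := h1
  let d : (Fin m → ℤ) → ℝ := fun q =>
    |∑ i : Fin m, (q i : ℝ) * v i - round (∑ i : Fin m, (q i : ℝ) * v i)| *
      (N q : ℝ) ^ ((m:ℝ) + ε)
  have hNp : ∀ q : Fin m → ℤ, q ≠ 0 → 0 < (N q : ℝ) ^ ((m:ℝ) + ε) := by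
    intro q hq
    have h1 : (1:ℝ) ≤ N q := by exact_mod_cast kg_sup_pos q hq
    exact Real.rpow_pos_of_pos (by linarith) _
  have hd : ∀ q, q ≠ 0 → 0 < d q := by
    intro q hq
    refine mul_pos (abs_pos.2 ?_) (hNp q hq)
    have := h2 q hq (-round (∑ i : Fin m, (q i : ℝ) * v i))
    push_cast at this
    rwa [neg_add_eq_sub] at this
  have hfinc : ∀ F : Finset (Fin m → ℤ), ∃ c : ℝ, 0 < c ∧ c ≤ 1 ∧ ∀ q ∈ F, q ≠ 0 → c ≤ d q := by
    intro F
    induction F using Finset.induction_on with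
    | empty => exact ⟨1, one_pos, le_rfl, by simp⟩
    | insert a F _ ih =>
      obtain ⟨c, hc, hc1, h⟩ := ih
      by_cases ha : a = 0
      · refine ⟨c, hc, hc1, fun q hq hq0 => ?_⟩
        rcases Finset.mem_insert.1 hq with rfl | hq
        · exact absurd ha hq0
        · exact h q hq hq0
      · refine ⟨min c (d a), lt_min hc (hd a ha), (min_le_left _ _).trans hc1, fun q hq hq0 => ?_⟩
        rcases Finset.mem_insert.1 hq with rfl | hq
        · exact min_le_right _ _
        · exact (min_le_left _ _).trans (h q hq hq0)
  obtain ⟨c, hc, hc1, h⟩ := hfinc hfin.toFinset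
  refine ⟨c, hc, fun q hq p => ?_⟩
  rw [div_le_iff₀ (hNp q hq)]
  by_cases hmem : v ∈ s q
  · refine (h q (by simpa using hmem) hq).trans ?_
    refine mul_le_mul_of_nonneg_right ?_ (hNp q hq).le
    have := round_le (∑ i : Fin m, (q i : ℝ) * v i) (-p)
    push_cast at this
    rwa [sub_neg_eq_add, add_comm _ (p:ℝ)] at this
  · have : (N q : ℝ) ^ (-((m:ℝ) + ε)) ≤ |(p : ℝ) + ∑ i : Fin m, (q i : ℝ) * v i| := by
      by_contra hcon
      exact hmem ⟨hq, p, not_le.1 hcon⟩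
    rw [Real.rpow_neg (Nat.cast_nonneg _), inv_le_iff_one_le_mul₀ (hNp q hq)] at this
    exact hc1.trans this

/-- Khintchine–Groshev-type bound on linear forms. For
Lebesgue-almost every `v ∈ ℝ^m`, for every ε > 0 there exists c > 0 such that
for every nonzero integer vector q and every integer p,
`|p + ∑ i, q i * v i| ≥ c / (max i |q i|)^(m+ε)`. -/
theorem khintchine_groshev_linear_forms (m : ℕ) (hm : 0 < m) :
    ∀ᵐ v ∂(volume : Measure (Fin m → ℝ)),
      ∀ ε : ℝ, 0 < ε → ∃ c : ℝ, 0 < c ∧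
        ∀ q : Fin m → ℤ, q ≠ 0 → ∀ p : ℤ,
          c / (((Finset.univ.sup fun i : Fin m => (q i).natAbs : ℕ) : ℝ) ^ ((m : ℝ) + ε))
            ≤ |(p : ℝ) + ∑ i : Fin m, (q i : ℝ) * v i| := by
  have key : ∀ᵐ v ∂(volume : Measure (Fin m → ℝ)), ∀ R k : ℕ, (∀ i, |v i| < ((R + 1 : ℕ) : ℝ)) →
      ∃ c : ℝ, 0 < c ∧ ∀ q : Fin m → ℤ, q ≠ 0 → ∀ p : ℤ,
          c / (((Finset.univ.sup fun i : Fin m => (q i).natAbs : ℕ) : ℝ) ^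
            ((m : ℝ) + 1 / ((k : ℝ) + 1)))
            ≤ |(p : ℝ) + ∑ i : Fin m, (q i : ℝ) * v i| := by
    rw [ae_all_iff]
    intro R
    rw [ae_all_iff]
    intro k
    exact ae_imp_of_ae_restrict (kg_box m (R + 1) R.succ_pos (1 / ((k : ℝ) + 1)) (by positivity))
  filter_upwards [key] with v hv ε hε
  obtain ⟨k, hk⟩ := exists_nat_one_div_lt hε
  obtain ⟨R, hR⟩ := exists_nat_gt ‖v‖
  obtain ⟨c, hc, h⟩ := hv R k (fun i => by
    have := norm_le_pi_norm v i
    rw [Real.norm_eq_abs] at this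
    push_cast
    linarith)
  refine ⟨c, hc, fun q hq p => le_trans ?_ (h q hq p)⟩
  have h1 : (1:ℝ) ≤ ((Finset.univ.sup fun i : Fin m => (q i).natAbs : ℕ) : ℝ) := by
    exact_mod_cast kg_sup_pos q hq
  refine div_le_div_of_nonneg_left hc.le (Real.rpow_pos_of_pos (by linarith) _) ?_
  exact Real.rpow_le_rpow_of_exponent_le h1 (by linarith)
end
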